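/- arXiv:2006.14901 — 4 statements merged into one kernel-verified Lean document; each statement's English description precedes it below -/
import Mathlib

section
/- The function f : ℝ → ℝ defined by f(x) = x·sin(log(1/x)) for x > 0 and f(x) = 0 for x ≤ 0 is locally Lipschitz: for every bounded set S ⊆ ℝ there exists a constant L > 0 such that |f(x) − f(y)| ≤ L|x − y| for all x, y ∈ S. (In fact one may take L = 2.) -/
open Real Set

/-- The function `f(x) = x·sin(log(1/x))` for `x > 0` and `f(x) = 0` otherwise. -/
noncomputable def f0 (x : ℝ) : ℝ := if 0 < x then x * Real.sin (Real.log (1 / x)) else 0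

theorem f0_pos_lip {x y : ℝ} (hx : 0 < x) (hy : 0 < y) : |f0 x - f0 y| ≤ 2 * |x - y| := by
  have key : ∀ t ∈ Set.Ioi (0 : ℝ), HasDerivWithinAt (fun t : ℝ => t * Real.sin (-Real.log t))
      (1 * Real.sin (-Real.log t) + t * (Real.cos (-Real.log t) * (-t⁻¹))) (Set.Ioi 0) t := by
    intro t ht
    have ht0 : t ≠ 0 := ne_of_gt ht
    exact ((hasDerivAt_id t).mul ((Real.hasDerivAt_log ht0).neg.sin)).hasDerivWithinAt
  have bd : ∀ t ∈ Set.Ioi (0 : ℝ),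
      ‖1 * Real.sin (-Real.log t) + t * (Real.cos (-Real.log t) * (-t⁻¹))‖ ≤ 2 := by
    intro t ht
    have ht0 : t ≠ 0 := ne_of_gt ht
    have e : 1 * Real.sin (-Real.log t) + t * (Real.cos (-Real.log t) * (-t⁻¹))
        = Real.sin (-Real.log t) - Real.cos (-Real.log t) := by
      field_simp
      ring
    rw [e, Real.norm_eq_abs, abs_le]
    constructor <;> linarith [Real.sin_le_one (-Real.log t), Real.neg_one_le_sin (-Real.log t),
      Real.cos_le_one (-Real.log t), Real.neg_one_le_cos (-Real.log t)]
  have := (convex_Ioi (0 : ℝ)).norm_image_sub_le_of_norm_hasDerivWithin_le key bd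
    (Set.mem_Ioi.2 hy) (Set.mem_Ioi.2 hx)
  simpa only [f0, if_pos hx, if_pos hy, one_div, Real.log_inv, Real.norm_eq_abs] using this

theorem f0_abs_le {x : ℝ} (hx : 0 < x) : |f0 x| ≤ x := by
  rw [f0, if_pos hx, abs_mul, abs_of_pos hx]
  exact mul_le_of_le_one_right hx.le (Real.abs_sin_le_one _)

theorem f0_nonpos {x : ℝ} (hx : ¬ 0 < x) : f0 x = 0 := by
  rw [f0, if_neg hx]

/-- The function `f0` is locally Lipschitz: for every bounded set `S ⊆ ℝ` there exists a
constant `L > 0` such that `|f0 x − f0 y| ≤ L * |x − y|` for all `x, y ∈ S`. -/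
theorem stmt0 :
    ∀ S : Set ℝ, Bornology.IsBounded S →
      ∃ L > (0 : ℝ), ∀ x ∈ S, ∀ y ∈ S, |f0 x - f0 y| ≤ L * |x - y| := by
  intro S _
  refine ⟨2, by norm_num, fun x _ y _ => ?_⟩
  by_cases hx : 0 < x <;> by_cases hy : 0 < y
  · exact f0_pos_lip hx hy
  · rw [f0_nonpos hy, sub_zero]
    linarith [f0_abs_le hx, le_abs_self (x - y)]
  · rw [f0_nonpos hx, zero_sub, abs_neg]
    linarith [f0_abs_le hy, neg_le_abs (x - y)]
  · rw [f0_nonpos hx, f0_nonpos hy, sub_zero, abs_zero]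
    positivity
end

section
/- Let f₂ : ℝ → ℝ be f₂(x) = max{−x−1, min{−x, 0}}. Then the Fréchet subdifferential of f₂ at 0 is empty, while the limiting subdifferential of f₂ at 0 equals {−1, 0}; in particular 0 ∈ ∂f₂(0) but 0 ∉ ∂̂f₂(0), so 0 is a limiting stationary point that is not a directional (Fréchet) stationary point. Moreover, f₂'(0,1) = −1 < 0, so d = 1 is a descent direction of f₂ at 0. -/
open Filter Topology Set

/-- `f₂(x) = max{−x−1, min{−x, 0}}`. -/
noncomputable def f13 (x : ℝ) : ℝ := max (-x - 1) (min (-x) 0)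

/-- The Fréchet subdifferential of `f` at `x`. -/
noncomputable def fsub (f : ℝ → ℝ) (x : ℝ) : Set ℝ :=
  {s | 0 ≤ Filter.liminf (fun y : ℝ => (f y - f x - s * (y - x)) / |y - x|) (𝓝[≠] x)}

/-- The limiting subdifferential of `f` at `x`. -/
noncomputable def lsub (f : ℝ → ℝ) (x : ℝ) : Set ℝ :=
  {s | ∃ xk sk : ℕ → ℝ, Tendsto xk atTop (𝓝 x) ∧ Tendsto sk atTop (𝓝 s) ∧
    ∀ k, sk k ∈ fsub f (xk k)}

lemma liminf_two (q : ℝ → ℝ) (x a b : ℝ) (hr : ∀ᶠ y in 𝓝[>] x, q y = a)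
    (hl : ∀ᶠ y in 𝓝[<] x, q y = b) : Filter.liminf q (𝓝[≠] x) = min a b := by
  rw [Filter.liminf_eq]
  have : {c | ∀ᶠ y in 𝓝[≠] x, c ≤ q y} = Set.Iic (min a b) := by
    ext c
    simp only [Set.mem_setOf_eq, Set.mem_Iic, le_min_iff]
    rw [← nhdsLT_sup_nhdsGT, Filter.eventually_sup]
    constructor
    · rintro ⟨h1, h2⟩
      obtain ⟨y, hy, hy'⟩ := (h1.and hl).exists
      obtain ⟨z, hz, hz'⟩ := (h2.and hr).exists
      exact ⟨hz' ▸ hz, hy' ▸ hy⟩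
    · rintro ⟨h1, h2⟩
      exact ⟨hl.mono fun y hy => hy ▸ h2, hr.mono fun y hy => hy ▸ h1⟩
  rw [this, csSup_Iic]

lemma mem_fsub_two (f : ℝ → ℝ) (x a b s : ℝ) (hr : ∀ᶠ y in 𝓝[>] x, f y = f x + a * (y - x))
    (hl : ∀ᶠ y in 𝓝[<] x, f y = f x + b * (y - x)) : s ∈ fsub f x ↔ s ≤ a ∧ b ≤ s := by
  unfold fsub
  rw [Set.mem_setOf_eq, liminf_two _ x (a - s) (s - b), le_min_iff, sub_nonneg, sub_nonneg]
  · filter_upwards [hr, self_mem_nhdsWithin] with y hy hxy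
    have h : 0 < y - x := sub_pos.2 hxy
    rw [hy, abs_of_pos h, div_eq_iff h.ne']
    ring
  · filter_upwards [hl, self_mem_nhdsWithin] with y hy hxy
    have h : y - x < 0 := sub_neg.2 hxy
    rw [hy, abs_of_neg h, div_eq_iff (neg_pos.2 h).ne']
    ring

lemma f13_pos {x : ℝ} (h : 0 ≤ x) : f13 x = -x := by
  unfold f13
  rw [min_eq_left (by linarith), max_eq_right (by linarith)]

lemma f13_neg {x : ℝ} (h : x ≤ 0) (h' : -1 ≤ x) : f13 x = 0 := by
  unfold f13
  rw [min_eq_right (by linarith), max_eq_right (by linarith)]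

lemma fsub_zero (s : ℝ) : s ∉ fsub f13 0 := by
  rw [mem_fsub_two f13 0 (-1) 0]
  · rintro ⟨h1, h2⟩
    linarith
  · filter_upwards [self_mem_nhdsWithin] with y hy
    rw [f13_pos (le_of_lt hy), f13_pos le_rfl]
    ring
  · filter_upwards [Ioo_mem_nhdsLT (show (-1 : ℝ) < 0 by norm_num)] with y hy
    rw [f13_neg hy.2.le hy.1.le, f13_pos le_rfl]
    ring

lemma fsub_pos {x : ℝ} (hx : 0 < x) (s : ℝ) : s ∈ fsub f13 x ↔ s = -1 := by
  have h : ∀ᶠ y in 𝓝 x, f13 y = f13 x + (-1) * (y - x) := by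
    filter_upwards [Ioi_mem_nhds hx] with y hy
    rw [f13_pos (le_of_lt hy), f13_pos hx.le]
    ring
  rw [mem_fsub_two f13 x (-1) (-1) s (h.filter_mono nhdsWithin_le_nhds)
    (h.filter_mono nhdsWithin_le_nhds), le_antisymm_iff]

lemma fsub_neg {x : ℝ} (hx : x < 0) (hx' : -1 < x) (s : ℝ) : s ∈ fsub f13 x ↔ s = 0 := by
  have h : ∀ᶠ y in 𝓝 x, f13 y = f13 x + 0 * (y - x) := by
    filter_upwards [Ioo_mem_nhds hx' hx] with y hy
    rw [f13_neg hy.2.le hy.1.le, f13_neg hx.le hx'.le]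
    ring
  rw [mem_fsub_two f13 x 0 0 s (h.filter_mono nhdsWithin_le_nhds)
    (h.filter_mono nhdsWithin_le_nhds), le_antisymm_iff]

lemma lim_aux (c : ℝ) : Tendsto (fun k : ℕ => c * (1 / ((k : ℝ) + 1))) atTop (𝓝 0) := by
  simpa using (tendsto_one_div_add_atTop_nhds_zero_nat (𝕜 := ℝ)).const_mul c

lemma lsub_zero : lsub f13 0 = {-1, 0} := by
  ext s
  constructor
  · rintro ⟨xk, sk, hx, hs, h⟩
    have hc : IsClosed ({-1, 0} : Set ℝ) := (Set.toFinite _).isClosed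
    refine hc.mem_of_tendsto hs ?_
    filter_upwards [hx.eventually (Ioi_mem_nhds (show (-1 : ℝ) < 0 by norm_num))] with k hk
    have hk' := h k
    rcases lt_trichotomy (xk k) 0 with h0 | h0 | h0
    · exact Or.inr ((fsub_neg h0 hk _).1 hk')
    · rw [h0] at hk'
      exact absurd hk' (fsub_zero _)
    · exact Or.inl ((fsub_pos h0 _).1 hk')
  · rintro (rfl | rfl)
    · refine ⟨_, fun _ => -1, lim_aux 1, tendsto_const_nhds, fun k => ?_⟩
      exact (fsub_pos (by positivity) _).2 rfl
    · refine ⟨_, fun _ => 0, lim_aux (-1 / 2), tendsto_const_nhds, fun k => ?_⟩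
      have h1 : 0 < 1 / ((k : ℝ) + 1) := by positivity
      have h2 : 1 / ((k : ℝ) + 1) ≤ 1 := by
        rw [div_le_one (by positivity)]
        linarith [(Nat.cast_nonneg k : (0 : ℝ) ≤ k)]
      exact (fsub_neg (by linarith) (by linarith) _).2 rfl

/-- For `f₂(x) = max{−x−1, min{−x,0}}`: the Fréchet subdifferential at `0` is empty while the
limiting subdifferential at `0` equals `{−1, 0}`; in particular `0 ∈ ∂f₂(0)` but
`0 ∉ ∂̂f₂(0)`, so `0` is a limiting stationary point that is not a directional (Fréchet)
stationary point. Moreover `f₂'(0,1) = −1 < 0`, so `d = 1` is a descent direction at `0`. -/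
theorem stmt13 :
    fsub f13 0 = ∅ ∧
    lsub f13 0 = {-1, 0} ∧
    (0 : ℝ) ∈ lsub f13 0 ∧
    (0 : ℝ) ∉ fsub f13 0 ∧
    Tendsto (fun t : ℝ => (f13 (0 + t * 1) - f13 0) / t) (𝓝[>] 0) (𝓝 (-1)) ∧
    (∃ tb > (0 : ℝ), ∀ t ∈ Set.Ioo 0 tb, f13 (0 + t * 1) < f13 0) := by
  refine ⟨Set.eq_empty_of_forall_notMem fsub_zero, lsub_zero, ?_, fsub_zero 0, ?_, 1, one_pos, ?_⟩
  · rw [lsub_zero]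
    exact Or.inr rfl
  · refine tendsto_const_nhds.congr' ?_
    filter_upwards [self_mem_nhdsWithin] with t ht
    have ht' : 0 < t := ht
    rw [zero_add, mul_one, f13_pos ht'.le, f13_pos le_rfl, eq_div_iff ht'.ne']
    ring
  · intro t ht
    rw [zero_add, mul_one, f13_pos ht.1.le, f13_pos le_rfl]
    linarith [ht.1]
end

section
/- Let g : ℝᵐ → ℝ be convex and L-Lipschitz continuous on ℝᵐ, and let F : ℝⁿ → ℝᵐ be differentiable with β-Lipschitz continuous derivative, i.e., ‖JF(x) − JF(y)‖ ≤ β‖x − y‖ in the operator norm for all x, y. Then the composite function f = g ∘ F is (Lβ)-weakly convex: the function x ↦ g(F(x)) + (Lβ/2)‖x‖² is convex on ℝⁿ. -/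
open Set

theorem stmt17_taylor {E G : Type*} [NormedAddCommGroup E] [NormedSpace ℝ E]
    [NormedAddCommGroup G] [NormedSpace ℝ G] (F : E → G) (β : ℝ)
    (hF : Differentiable ℝ F)
    (hJF : ∀ x y, ‖fderiv ℝ F x - fderiv ℝ F y‖ ≤ β * ‖x - y‖) (z h : E) :
    ‖F (z + h) - F z - fderiv ℝ F z h‖ ≤ β / 2 * ‖h‖ ^ 2 := by
  have hd : ∀ t : ℝ, HasDerivAt (fun t : ℝ => F (z + t • h) - F z - t • fderiv ℝ F z h)
      (fderiv ℝ F (z + t • h) h - fderiv ℝ F z h) t := by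
    intro t
    have h1 : HasDerivAt (fun t : ℝ => z + t • h) h t := by
      simpa using ((hasDerivAt_id t).smul_const h).const_add z
    have h2 := (hF (z + t • h)).hasFDerivAt.comp_hasDerivAt t h1
    have h3 : HasDerivAt (fun t : ℝ => t • fderiv ℝ F z h) (fderiv ℝ F z h) t := by
      simpa using (hasDerivAt_id t).smul_const (fderiv ℝ F z h)
    exact (h2.sub_const (F z)).sub h3
  have hB : ∀ t : ℝ, HasDerivAt (fun t : ℝ => β / 2 * ‖h‖ ^ 2 * t ^ 2) (β * ‖h‖ ^ 2 * t) t := by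
    intro t
    refine ((hasDerivAt_pow 2 t).const_mul (β / 2 * ‖h‖ ^ 2)).congr_deriv ?_
    simp only [Nat.cast_ofNat, Nat.add_one_sub_one, pow_one]
    ring
  have key := image_norm_le_of_norm_deriv_right_le_deriv_boundary (a := 0) (b := 1)
    (fun t _ => (hd t).continuousAt.continuousWithinAt)
    (fun t _ => (hd t).hasDerivWithinAt) (by simp) hB
    (by
      intro t ht
      have h1 := (fderiv ℝ F (z + t • h) - fderiv ℝ F z).le_opNorm h
      have h2 := hJF (z + t • h) z
      rw [add_sub_cancel_left, norm_smul, Real.norm_of_nonneg ht.1] at h2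
      have h3 := mul_le_mul_of_nonneg_right h2 (norm_nonneg h)
      rw [ContinuousLinearMap.sub_apply] at h1
      linarith)
    (right_mem_Icc.2 zero_le_one)
  simpa using key

/-- Let `g : ℝᵐ → ℝ` be convex and `L`-Lipschitz, and let `F : ℝⁿ → ℝᵐ` be differentiable
with `β`-Lipschitz derivative (in operator norm). Then `f = g ∘ F` is `(Lβ)`-weakly convex:
`x ↦ g(F(x)) + (Lβ/2)‖x‖²` is convex. -/
theorem stmt17 (n m : ℕ) (g : EuclideanSpace ℝ (Fin m) → ℝ)
    (F : EuclideanSpace ℝ (Fin n) → EuclideanSpace ℝ (Fin m))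
    (L β : ℝ) (hL : 0 ≤ L) (hβ : 0 ≤ β)
    (hgconv : ConvexOn ℝ Set.univ g)
    (hgLip : ∀ u v, |g u - g v| ≤ L * ‖u - v‖)
    (hF : Differentiable ℝ F)
    (hJF : ∀ x y, ‖fderiv ℝ F x - fderiv ℝ F y‖ ≤ β * ‖x - y‖) :
    ConvexOn ℝ Set.univ (fun x => g (F x) + (L * β / 2) * ‖x‖ ^ 2) := by
  refine ⟨convex_univ, ?_⟩
  intro x _ y _ a b ha hb hab
  have hb' : b = 1 - a := by linarith
  obtain ⟨z, hz⟩ : ∃ z, z = a • x + b • y := ⟨_, rfl⟩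
  have hx : z + b • (x - y) = x := by rw [hz, hb']; module
  have hy : z + (-a) • (x - y) = y := by rw [hz, hb']; module
  have tx := stmt17_taylor F β hF hJF z (b • (x - y))
  have ty := stmt17_taylor F β hF hJF z ((-a) • (x - y))
  rw [hx, norm_smul, map_smul, Real.norm_of_nonneg hb] at tx
  rw [hy, norm_smul, map_smul, norm_neg, Real.norm_of_nonneg ha] at ty
  have hdec : F z - (a • F x + b • F y) =
      -(a • (F x - F z - b • fderiv ℝ F z (x - y))
        + b • (F y - F z - (-a) • fderiv ℝ F z (x - y))) := by
    rw [hb']; module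
  have hn : ‖F z - (a • F x + b • F y)‖ ≤ β / 2 * (a * b * ‖x - y‖ ^ 2) := by
    rw [hdec, norm_neg]
    refine (norm_add_le _ _).trans ?_
    rw [norm_smul, norm_smul, Real.norm_of_nonneg ha, Real.norm_of_nonneg hb]
    have h1 := mul_le_mul_of_nonneg_left tx ha
    have h2 := mul_le_mul_of_nonneg_left ty hb
    refine (add_le_add h1 h2).trans (le_of_eq ?_)
    rw [hb']; ring
  have hg1 := (le_abs_self _).trans (hgLip (F z) (a • F x + b • F y))
  have hg2 := hgconv.2 (mem_univ (F x)) (mem_univ (F y)) ha hb hab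
  have hg3 := mul_le_mul_of_nonneg_left hn hL
  have hsq : ‖z‖ ^ 2 = a * ‖x‖ ^ 2 + b * ‖y‖ ^ 2 - a * b * ‖x - y‖ ^ 2 := by
    rw [hz, norm_add_sq_real, norm_sub_sq_real, norm_smul, norm_smul, real_inner_smul_left,
      real_inner_smul_right, Real.norm_of_nonneg ha, Real.norm_of_nonneg hb, hb']
    ring
  simp only [smul_eq_mul] at hg2 ⊢
  rw [← hz, hsq]
  linarith
end

section
/- Let θ > 0. Then the function x ↦ log(|x| + θ) + x²/(2θ²) is convex on ℝ. Consequently, the logarithmic sum penalty R : ℝⁿ → ℝ given by R(x) = Σᵢ log(|xᵢ| + θ) is (1/θ²)-weakly convex: the function x ↦ R(x) + (1/(2θ²))‖x‖² is convex on ℝⁿ. -/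
open Set

lemma aux_deriv (θ : ℝ) (hθ : 0 < θ) (t : ℝ) (ht : 0 ≤ t) :
    HasDerivAt (fun t : ℝ => Real.log (t + θ) + t ^ 2 / (2 * θ ^ 2))
      (1 / (t + θ) + t / θ ^ 2) t := by
  have h1 := ((hasDerivAt_id t).add_const θ).log (by simp; positivity)
  have h2 := ((hasDerivAt_id t).pow 2).div_const (2 * θ ^ 2)
  refine (h1.add h2).congr_deriv ?_
  simp
  field_simp

lemma aux_cont (θ : ℝ) (hθ : 0 < θ) :
    ContinuousOn (fun t : ℝ => Real.log (t + θ) + t ^ 2 / (2 * θ ^ 2)) (Ici 0) :=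
  fun t ht => (aux_deriv θ hθ t ht).continuousAt.continuousWithinAt

lemma aux_mono (θ : ℝ) (hθ : 0 < θ) :
    MonotoneOn (fun t : ℝ => Real.log (t + θ) + t ^ 2 / (2 * θ ^ 2)) (Ici 0) := by
  intro s hs t ht hst
  have hs' : 0 ≤ s := hs
  have h : Real.log (s + θ) ≤ Real.log (t + θ) :=
    Real.log_le_log (by positivity) (by linarith)
  have h2 : s ^ 2 / (2 * θ ^ 2) ≤ t ^ 2 / (2 * θ ^ 2) := by gcongr
  exact add_le_add h h2

lemma aux_convex (θ : ℝ) (hθ : 0 < θ) :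
    ConvexOn ℝ (Ici 0) (fun t : ℝ => Real.log (t + θ) + t ^ 2 / (2 * θ ^ 2)) := by
  apply MonotoneOn.convexOn_of_deriv (convex_Ici 0) (aux_cont θ hθ)
  · intro t ht
    rw [interior_Ici] at ht
    exact (aux_deriv θ hθ t (le_of_lt ht)).differentiableAt.differentiableWithinAt
  · rw [interior_Ici]
    intro s hs t ht hst
    have hs' : 0 < s := hs
    have ht' : 0 < t := ht
    rw [(aux_deriv θ hθ s hs'.le).deriv, (aux_deriv θ hθ t ht'.le).deriv]
    have key : (1 / (t + θ) + t / θ ^ 2) - (1 / (s + θ) + s / θ ^ 2)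
        = (t - s) * ((s + θ) * (t + θ) - θ ^ 2) / (θ ^ 2 * (s + θ) * (t + θ)) := by
      field_simp
      ring
    have h3 : 0 ≤ (s + θ) * (t + θ) - θ ^ 2 := by
      have : (s + θ) * (t + θ) - θ ^ 2 = s * t + s * θ + t * θ := by ring
      rw [this]; positivity
    have h4 : 0 ≤ t - s := by linarith
    have : 0 ≤ (t - s) * ((s + θ) * (t + θ) - θ ^ 2) / (θ ^ 2 * (s + θ) * (t + θ)) := by
      positivity
    linarith

lemma aux_one (θ : ℝ) (hθ : 0 < θ) :
    ConvexOn ℝ Set.univ (fun x : ℝ => Real.log (|x| + θ) + x ^ 2 / (2 * θ ^ 2)) := by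
  refine ⟨convex_univ, ?_⟩
  intro x _ y _ a b ha hb hab
  have h1 := (aux_convex θ hθ).2 (abs_nonneg x) (abs_nonneg y) ha hb hab
  have h2 : |a • x + b • y| ≤ a • |x| + b • |y| := by
    simp only [smul_eq_mul]
    calc _ ≤ |a * x| + |b * y| := abs_add_le _ _
      _ = _ := by rw [abs_mul, abs_mul, abs_of_nonneg ha, abs_of_nonneg hb]
  have h3 := aux_mono θ hθ (abs_nonneg (a • x + b • y)) ((abs_nonneg _).trans h2) h2
  have h4 := h3.trans h1
  simpa only [sq_abs] using h4

/-- For `θ > 0`, the function `x ↦ log(|x| + θ) + x²/(2θ²)` is convex on `ℝ`; consequently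
the logarithmic sum penalty `R(x) = Σᵢ log(|xᵢ| + θ)` is `(1/θ²)`-weakly convex:
`x ↦ R(x) + (1/(2θ²))‖x‖²` is convex on `ℝⁿ`. -/
theorem stmt18 (θ : ℝ) (hθ : 0 < θ) :
    ConvexOn ℝ Set.univ (fun x : ℝ => Real.log (|x| + θ) + x ^ 2 / (2 * θ ^ 2)) ∧
    ∀ n : ℕ, ConvexOn ℝ Set.univ
      (fun x : EuclideanSpace ℝ (Fin n) =>
        (∑ i, Real.log (|x i| + θ)) + (1 / (2 * θ ^ 2)) * ‖x‖ ^ 2) := by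
  refine ⟨aux_one θ hθ, fun n => ?_⟩
  have e : (fun x : EuclideanSpace ℝ (Fin n) =>
        (∑ i, Real.log (|x i| + θ)) + (1 / (2 * θ ^ 2)) * ‖x‖ ^ 2)
      = fun x => ∑ i, (Real.log (|x i| + θ) + (x i) ^ 2 / (2 * θ ^ 2)) := by
    funext x
    rw [EuclideanSpace.real_norm_sq_eq, Finset.sum_add_distrib, Finset.mul_sum]
    congr 1
    exact Finset.sum_congr rfl fun i _ => by ring
  rw [e]
  refine ⟨convex_univ, ?_⟩
  intro x _ y _ a b ha hb hab
  simp only [Finset.smul_sum, ← Finset.sum_add_distrib]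
  refine Finset.sum_le_sum fun i _ => ?_
  exact (aux_one θ hθ).2 (mem_univ (x i)) (mem_univ (y i)) ha hb hab
end
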